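/- For every integer k with 2 ≤ k and 2k ≤ n and every sign ε ∈ {1,−1}, the stabilizer in 𝔟 of the linear form Z ↦ trace(X_{k,ε}·Z) on 𝔟 equals the centralizer of X_{k,ε} in 𝔟; that is, { Y ∈ 𝔟 : trace(X_{k,ε}·(Y·Z − Z·Y)) = 0 for all Z ∈ 𝔟 } = { Y ∈ 𝔟 : X_{k,ε}·Y = Y·X_{k,ε} }. -/

import Mathlib

open Matrix

/-- The n×n real matrix unit `E_{a,b}` (1-based indices). -/
noncomputable def Ematrix (n a b : ℕ) : Matrix (Fin n) (Fin n) ℝ :=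
  fun s t => if (s : ℕ) + 1 = a ∧ (t : ℕ) + 1 = b then 1 else 0

/-- `X_{k,ε} = Σ_{i=1}^{k−1} E_{n+1−i,i} + ε·E_{n+1−k,k}`. -/
noncomputable def Xmat (n k : ℕ) (ε : ℝ) : Matrix (Fin n) (Fin n) ℝ :=
  (∑ i ∈ Finset.Icc 1 (k - 1), Ematrix n (n + 1 - i) i) + ε • Ematrix n (n + 1 - k) k

/-- The Borel subalgebra `𝔟` of upper-triangular traceless real n×n matrices, as a set. -/
def borelSet (n : ℕ) : Set (Matrix (Fin n) (Fin n) ℝ) :=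
  {Y | Y.trace = 0 ∧ ∀ s t : Fin n, (t : ℕ) < (s : ℕ) → Y s t = 0}

theorem Xmat_apply {n k : ℕ} (hk : 2 ≤ k) (hkn : 2 * k ≤ n) (ε : ℝ) (s t : Fin n) :
    Xmat n k ε s t =
      if t = s.rev ∧ (t : ℕ) < k then (if (t : ℕ) + 1 = k then ε else 1) else 0 := by
  have hrev : t = s.rev ↔ (s : ℕ) + t + 1 = n := by
    rw [Fin.ext_iff, Fin.val_rev]
    omega
  have hsum : (∑ i ∈ Finset.Icc 1 (k - 1), Ematrix n (n + 1 - i) i) s t =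
      if (s : ℕ) + t + 1 = n ∧ (t : ℕ) + 1 < k then 1 else 0 := by
    rw [Matrix.sum_apply]
    simp only [Ematrix]
    by_cases h : (s : ℕ) + t + 1 = n ∧ (t : ℕ) + 1 < k
    · rw [if_pos h, Finset.sum_eq_single ((t : ℕ) + 1)]
      · rw [if_pos ⟨by omega, rfl⟩]
      · intro i _ hi
        rw [if_neg (by omega)]
      · intro hi
        rw [Finset.mem_Icc] at hi
        omega
    · rw [if_neg h]
      refine Finset.sum_eq_zero fun i hi => ?_
      rw [Finset.mem_Icc] at hi
      rw [if_neg (by omega)]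
  rw [Xmat, Matrix.add_apply, hsum, Matrix.smul_apply]
  simp only [hrev, Ematrix, smul_eq_mul]
  split_ifs <;> first | omega | simp

theorem Xmat_mul_apply {n k : ℕ} (hk : 2 ≤ k) (hkn : 2 * k ≤ n) (ε : ℝ)
    (Y : Matrix (Fin n) (Fin n) ℝ) (s t : Fin n) :
    (Xmat n k ε * Y) s t =
      if (s.rev : ℕ) < k then (if (s.rev : ℕ) + 1 = k then ε else 1) * Y s.rev t else 0 := by
  rw [Matrix.mul_apply, Finset.sum_eq_single s.rev]
  · simp [Xmat_apply hk hkn]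
  · intro j _ hj
    simp [Xmat_apply hk hkn, hj]
  · simp

theorem mul_Xmat_apply {n k : ℕ} (hk : 2 ≤ k) (hkn : 2 * k ≤ n) (ε : ℝ)
    (Y : Matrix (Fin n) (Fin n) ℝ) (s t : Fin n) :
    (Y * Xmat n k ε) s t =
      if (t : ℕ) < k then (if (t : ℕ) + 1 = k then ε else 1) * Y s t.rev else 0 := by
  rw [Matrix.mul_apply, Finset.sum_eq_single t.rev]
  · simp [Xmat_apply hk hkn, mul_comm]
  · intro j _ hj
    have : t ≠ j.rev := fun h => hj (by rw [h, Fin.rev_rev])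
    simp [Xmat_apply hk hkn, this]
  · simp

theorem trace_mul_commutator {n : ℕ} (X Y Z : Matrix (Fin n) (Fin n) ℝ) :
    (X * (Y * Z - Z * Y)).trace = ((X * Y - Y * X) * Z).trace := by
  rw [mul_sub, sub_mul, trace_sub, trace_sub, ← mul_assoc, ← mul_assoc, trace_mul_comm (X * Z) Y,
    ← mul_assoc]

theorem single_mem_borelSet {n : ℕ} {a b : Fin n} (hab : a < b) :
    Matrix.single a b (1 : ℝ) ∈ borelSet n := by
  refine ⟨Matrix.trace_single_eq_of_ne _ _ _ hab.ne, fun s t hst => ?_⟩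
  rw [Matrix.single_apply, if_neg]
  rintro ⟨rfl, rfl⟩
  exact absurd hst (not_lt.2 (Fin.le_def.1 hab.le))

theorem single_sub_single_mem_borelSet {n : ℕ} (a b : Fin n) :
    Matrix.single a a (1 : ℝ) - Matrix.single b b 1 ∈ borelSet n := by
  refine ⟨by simp [Matrix.trace_sub], fun s t hst => ?_⟩
  have hne : s ≠ t := fun h => by simp [h] at hst
  rw [Matrix.sub_apply, Matrix.single_apply, Matrix.single_apply, if_neg, if_neg, sub_zero]
  · rintro ⟨rfl, rfl⟩
    exact hne rfl
  · rintro ⟨rfl, rfl⟩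
    exact hne rfl

/-- If `[X, Y]` vanishes below the diagonal and its diagonal is invariant under reversing the
indices, then `X` and `Y` commute. -/
theorem Xmat_commute_of_lower_eq_zero {n k : ℕ} (hk : 2 ≤ k) (hkn : 2 * k ≤ n) {ε : ℝ}
    (hε : ε ≠ 0) (Y : Matrix (Fin n) (Fin n) ℝ)
    (hlow : ∀ a b : Fin n, a < b → (Xmat n k ε * Y - Y * Xmat n k ε) b a = 0)
    (hdiag : ∀ a : Fin n, (Xmat n k ε * Y - Y * Xmat n k ε) a a =
      (Xmat n k ε * Y - Y * Xmat n k ε) a.rev a.rev) :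
    Xmat n k ε * Y = Y * Xmat n k ε := by
  have hx : ∀ i : ℕ, (if i + 1 = k then ε else 1) ≠ 0 := fun i => by
    split_ifs
    exacts [hε, one_ne_zero]
  simp only [Matrix.sub_apply, Xmat_mul_apply hk hkn, mul_Xmat_apply hk hkn,
    Fin.rev_rev] at hlow hdiag
  ext s t
  rw [Xmat_mul_apply hk hkn, mul_Xmat_apply hk hkn, ← sub_eq_zero]
  have hs := Fin.val_rev s
  have ht := Fin.val_rev t
  rcases lt_trichotomy s t with hst | rfl | hst
  · have hst' := Fin.lt_def.1 hst
    by_cases h₁ : (s.rev : ℕ) < k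
    · have h := hlow t.rev s.rev (Fin.rev_lt_rev.2 hst)
      rw [Fin.rev_rev, Fin.rev_rev, if_neg (by omega), if_pos (by omega), zero_sub, neg_eq_zero,
        mul_eq_zero, or_iff_right (hx _)] at h
      rw [h, if_neg (by omega : ¬ (t : ℕ) < k)]
      simp
    · by_cases h₂ : (t : ℕ) < k
      · have h := hlow t.rev s.rev (Fin.rev_lt_rev.2 hst)
        rw [Fin.rev_rev, if_pos (by omega : (s : ℕ) < k), if_neg (by omega : ¬ (t.rev : ℕ) < k), sub_zero,
          mul_eq_zero, or_iff_right (hx _)] at h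
        rw [h, if_neg h₁]
        simp
      · rw [if_neg h₁, if_neg h₂, sub_zero]
  · have h := hdiag s
    linarith
  · exact hlow t s hst

theorem form_stabilizer_eq_centralizer_in_borel (n : ℕ) (hn : 4 ≤ n) (k : ℕ)
    (hk : 2 ≤ k) (hkn : 2 * k ≤ n) (ε : ℝ) (hε : ε = 1 ∨ ε = -1) :
    {Y | Y ∈ borelSet n ∧ ∀ Z ∈ borelSet n,
        (Xmat n k ε * (Y * Z - Z * Y)).trace = 0} =
      {Y | Y ∈ borelSet n ∧ Xmat n k ε * Y = Y * Xmat n k ε} := by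
  ext Y
  simp only [Set.mem_ofPred_eq, trace_mul_commutator]
  refine and_congr_right fun _ => ⟨fun h => ?_, fun h Z _ => by simp [h]⟩
  have hε₀ : ε ≠ 0 := by rcases hε with rfl | rfl <;> norm_num
  refine Xmat_commute_of_lower_eq_zero hk hkn hε₀ Y (fun a b hab => ?_) fun a => ?_
  · simpa [Matrix.trace_mul_single] using h _ (single_mem_borelSet hab)
  · have := h _ (single_sub_single_mem_borelSet a a.rev)
    rw [mul_sub, Matrix.trace_sub, sub_eq_zero] at this
    simpa [Matrix.trace_mul_single] using this
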